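/- arXiv:2102.10261 — 4 statements merged into one kernel-verified Lean document; each statement's English description precedes it below -/
import Mathlib

section
/- There exists a constant d ∈ ℕ such that for every n ≥ 1 there exists a finite simple graph G on n vertices whose maximum degree is at most d and whose expansion satisfies h(G) ≥ 1; equivalently, |E(S, V∖S)| ≥ |S| for every subset S of the vertex set V with |S| ≤ |V|/2. -/
open Finset
open scoped Classical

/-- The permutations of `Fin n` that map `S` into `T`. -/
noncomputable def permsInto {n : ℕ} (S T : Finset (Fin n)) : Finset (Equiv.Perm (Fin n)) :=
  univ.filter fun σ => ∀ v ∈ S, σ v ∈ T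

theorem mem_permsInto {n : ℕ} {S T : Finset (Fin n)} {σ : Equiv.Perm (Fin n)} :
    σ ∈ permsInto S T ↔ ∀ v ∈ S, σ v ∈ T := by
  simp [permsInto]

theorem card_permsInto_insert_mul_le {n : ℕ} (S T : Finset (Fin n)) {v : Fin n} (hv : v ∉ S) :
    (permsInto (insert v S) T).card * (n - S.card) ≤
      (permsInto S T).card * (T.card - S.card) := by
  have hL : (permsInto (insert v S) T).card * (n - S.card) =
      (permsInto (insert v S) T ×ˢ Sᶜ).card := by
    rw [card_product, card_compl, Fintype.card_fin]
  have hR : (permsInto S T).card * (T.card - S.card) =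
      ((permsInto S T).sigma fun σ => T \ S.image σ).card := by
    rw [card_sigma, Finset.sum_const_nat]
    intro σ hσ
    rw [mem_permsInto] at hσ
    rw [card_sdiff_of_subset (by simpa [subset_iff] using hσ),
      card_image_of_injective _ σ.injective]
  rw [hL, hR]
  refine card_le_card_of_injOn
    (fun p => ⟨p.1 * Equiv.swap v p.2, p.1 v⟩) ?_ ?_
  · rintro ⟨σ, w⟩ h
    simp only [coe_product, Set.mem_prod, mem_coe, mem_permsInto, mem_compl] at h
    obtain ⟨hσ, hw⟩ := h
    simp only [coe_sigma, Set.mem_sigma_iff, mem_coe, mem_permsInto, mem_sdiff, mem_image,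
      Equiv.Perm.mul_apply]
    have key : ∀ u ∈ S, Equiv.swap v w u = u := fun u hu =>
      Equiv.swap_apply_of_ne_of_ne (fun h => hv (h ▸ hu)) (fun h => hw (h ▸ hu))
    refine ⟨fun u hu => ?_, hσ v (mem_insert_self _ _), ?_⟩
    · rw [key u hu]; exact hσ u (mem_insert_of_mem hu)
    · rintro ⟨u, hu, h⟩
      rw [key u hu] at h
      exact hv (σ.injective h ▸ hu)
  · rintro ⟨σ, w⟩ - ⟨τ, x⟩ - h
    simp only [Sigma.mk.injEq, heq_eq_eq] at h
    obtain ⟨h₁, h₂⟩ := h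
    have hwx : w = x := by
      have h₃ := congrArg (fun ρ : Equiv.Perm (Fin n) => ρ w) h₁
      simp only [Equiv.Perm.mul_apply, Equiv.swap_apply_right] at h₃
      rw [h₂] at h₃
      have h₄ := τ.injective h₃
      have h₅ := congrArg (Equiv.swap v x) h₄
      rw [Equiv.swap_apply_left, Equiv.swap_apply_self] at h₅
      exact h₅.symm
    subst hwx
    rw [mul_right_cancel h₁]

theorem card_permsInto_mul_pow_le {n : ℕ} (S T : Finset (Fin n)) :
    (permsInto S T).card * n ^ S.card ≤ n.factorial * T.card ^ S.card := by
  induction S using Finset.induction_on with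
  | empty =>
    simpa [Fintype.card_perm] using card_le_univ (permsInto ∅ T)
  | insert v S hv ih =>
    have hstep := card_permsInto_insert_mul_le S T hv
    have hlt : S.card < n := by
      have := card_le_univ (insert v S)
      rw [card_insert_of_notMem hv, Fintype.card_fin] at this
      omega
    have hT : T.card ≤ n := by simpa using card_le_univ T
    rw [card_insert_of_notMem hv]
    have hcross : (T.card - S.card) * n ≤ T.card * (n - S.card) := by
      rcases le_total T.card S.card with h | h
      · simp [Nat.sub_eq_zero_of_le h]
      · zify [h, hlt.le]
        have : (T.card : ℤ) ≤ n := by exact_mod_cast hT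
        nlinarith [(Nat.cast_nonneg S.card : (0 : ℤ) ≤ S.card)]
    refine Nat.le_of_mul_le_mul_right (c := n - S.card) ?_ (by omega)
    calc (permsInto (insert v S) T).card * n ^ (S.card + 1) * (n - S.card)
        = ((permsInto (insert v S) T).card * (n - S.card)) * n ^ (S.card + 1) := by ring
      _ ≤ ((permsInto S T).card * (T.card - S.card)) * n ^ (S.card + 1) := by gcongr
      _ = ((permsInto S T).card * n ^ S.card) * ((T.card - S.card) * n) := by ring
      _ ≤ (n.factorial * T.card ^ S.card) * (T.card * (n - S.card)) := by gcongr
      _ = n.factorial * T.card ^ (S.card + 1) * (n - S.card) := by ring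

theorem card_permsInto_le {n : ℕ} (hn : 0 < n) (S T : Finset (Fin n)) :
    ((permsInto S T).card : ℝ) ≤ n.factorial * ((T.card : ℝ) / n) ^ S.card := by
  have h : ((permsInto S T).card : ℝ) * (n : ℝ) ^ S.card ≤
      n.factorial * (T.card : ℝ) ^ S.card := by
    exact_mod_cast card_permsInto_mul_pow_le S T
  have hn' : (0 : ℝ) < n := by exact_mod_cast hn
  rw [div_pow, ← mul_div_assoc, le_div_iff₀ (by positivity)]
  exact h

/-- Union bound: some `k`-tuple of permutations avoids all containments `⋃ i, σ i '' S ⊆ T`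
with `(#S, #T)` in a prescribed set of pairs of sizes. -/
theorem exists_perms_not_mapsTo {n k : ℕ} (hn : 0 < n) (I : Finset (ℕ × ℕ))
    (hI : ∑ p ∈ I, (n.choose p.1 : ℝ) * n.choose p.2 * ((p.2 : ℝ) / n) ^ (p.1 * k) < 1) :
    ∃ σ : Fin k → Equiv.Perm (Fin n), ∀ S T : Finset (Fin n), (S.card, T.card) ∈ I →
      ∃ i, ∃ v ∈ S, σ i v ∉ T := by
  by_contra! hbad
  have hcover : (univ : Finset (Fin k → Equiv.Perm (Fin n))) ⊆
      I.biUnion fun p => (powersetCard p.1 univ ×ˢ powersetCard p.2 univ).biUnion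
        fun q => Fintype.piFinset fun _ : Fin k => permsInto q.1 q.2 := by
    intro σ _
    obtain ⟨S, T, hST, h⟩ := hbad σ
    simp only [mem_biUnion, mem_product, mem_powersetCard, Fintype.mem_piFinset, mem_permsInto]
    exact ⟨_, hST, (S, T), by simp, h⟩
  have hN : (0 : ℝ) < (n.factorial : ℝ) ^ k := by positivity
  have hle : (n.factorial : ℝ) ^ k ≤ ∑ p ∈ I, (n.factorial : ℝ) ^ k *
      ((n.choose p.1 : ℝ) * n.choose p.2 * ((p.2 : ℝ) / n) ^ (p.1 * k)) := by
    have h₁ := (card_le_card hcover).trans card_biUnion_le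
    have h₂ : (n.factorial : ℝ) ^ k ≤ ∑ p ∈ I, ((((powersetCard p.1 univ ×ˢ
        powersetCard p.2 univ : Finset (Finset (Fin n) × Finset (Fin n))).biUnion
        fun q => Fintype.piFinset fun _ : Fin k => permsInto q.1 q.2).card : ℕ) : ℝ) := by
      rw [card_univ, Fintype.card_fun, Fintype.card_perm, Fintype.card_fin, Fintype.card_fin] at h₁
      exact_mod_cast h₁
    refine h₂.trans (sum_le_sum fun p _ => ?_)
    refine (Nat.cast_le.2 card_biUnion_le).trans ?_
    rw [Nat.cast_sum]
    refine (sum_le_card_nsmul _ _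
      ((n.factorial : ℝ) ^ k * ((p.2 : ℝ) / n) ^ (p.1 * k)) fun q hq => ?_).trans ?_
    · simp only [mem_product, mem_powersetCard_univ] at hq
      rw [Fintype.card_piFinset_const, Nat.cast_pow, pow_mul, ← mul_pow, ← hq.1, ← hq.2]
      exact pow_le_pow_left₀ (Nat.cast_nonneg _) (card_permsInto_le hn _ _) k
    · rw [card_product, card_powersetCard, card_powersetCard, card_univ, Fintype.card_fin,
        nsmul_eq_mul, Nat.cast_mul]
      exact le_of_eq (by ring)
  rw [← mul_sum] at hle
  nlinarith

theorem choose_mul_div_pow_le (n t : ℕ) : (n.choose t : ℝ) * ((t : ℝ) / n) ^ t ≤ 3 ^ t := by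
  rcases Nat.eq_zero_or_pos n with rfl | hn
  · rcases Nat.eq_zero_or_pos t with rfl | ht
    · simp
    · simp [Nat.choose_eq_zero_of_lt ht]
  have hn' : (0 : ℝ) < n := by exact_mod_cast hn
  calc (n.choose t : ℝ) * ((t : ℝ) / n) ^ t
      ≤ ((n : ℝ) ^ t / t.factorial) * ((t : ℝ) / n) ^ t := by
        gcongr; exact Nat.choose_le_pow_div t n
    _ = (t : ℝ) ^ t / t.factorial := by rw [div_pow]; field_simp
    _ ≤ Real.exp t := Real.pow_div_factorial_le_exp _ (Nat.cast_nonneg _) _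
    _ = Real.exp 1 ^ t := by rw [← Real.exp_nat_mul, mul_one]
    _ ≤ 3 ^ t := by gcongr; exact (Real.exp_one_lt_d9.trans (by norm_num)).le

theorem choose_mul_choose_two_mul_le {n s k : ℕ} (hn : 0 < n) (hs : 4 * s ≤ n) (hk : 11 ≤ k) :
    (n.choose s : ℝ) * n.choose (2 * s) * (((2 * s : ℕ) : ℝ) / n) ^ (s * k) ≤ (1 / 4) ^ s := by
  have hn' : (0 : ℝ) < n := by exact_mod_cast hn
  obtain ⟨j, rfl⟩ := Nat.exists_eq_add_of_le hk
  have hx : ((2 * s : ℕ) : ℝ) / n ≤ 1 / 2 := by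
    rw [div_le_iff₀ hn']
    have : ((4 * s : ℕ) : ℝ) ≤ n := by exact_mod_cast hs
    push_cast at *
    linarith
  have h₁ := choose_mul_div_pow_le n s
  have h₂ := choose_mul_div_pow_le n (2 * s)
  have h₃ : (((2 * s : ℕ) : ℝ) / n) ^ s = 2 ^ s * ((s : ℝ) / n) ^ s := by
    rw [← mul_pow]; push_cast; ring
  calc (n.choose s : ℝ) * n.choose (2 * s) * (((2 * s : ℕ) : ℝ) / n) ^ (s * (11 + j))
      = (n.choose s * (((2 * s : ℕ) : ℝ) / n) ^ s) *
          (n.choose (2 * s) * (((2 * s : ℕ) : ℝ) / n) ^ (2 * s)) *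
          (((2 * s : ℕ) : ℝ) / n) ^ (s * (8 + j)) := by ring
    _ = 2 ^ s * (n.choose s * ((s : ℝ) / n) ^ s) *
          (n.choose (2 * s) * (((2 * s : ℕ) : ℝ) / n) ^ (2 * s)) *
          (((2 * s : ℕ) : ℝ) / n) ^ (s * (8 + j)) := by rw [h₃]; ring
    _ ≤ 2 ^ s * 3 ^ s * 3 ^ (2 * s) * (1 / 2) ^ (s * (8 + j)) := by gcongr
    _ ≤ 2 ^ s * 3 ^ s * 3 ^ (2 * s) * (1 / 2) ^ (s * 8) := by
        gcongr 2 ^ s * 3 ^ s * 3 ^ (2 * s) * ?_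
        exact pow_le_pow_of_le_one (by norm_num) (by norm_num) (by gcongr; omega)
    _ = (54 / 256) ^ s := by
        rw [pow_mul, mul_comm s 8, pow_mul, ← mul_pow, ← mul_pow, ← mul_pow]; norm_num
    _ ≤ (1 / 4) ^ s := pow_le_pow_left₀ (by norm_num) (by norm_num) s

theorem choose_mul_choose_sub_le {n m : ℕ} (hn : 0 < n) (hm : n ≤ 16 * m) (hmn : m ≤ n) :
    (n.choose m : ℝ) * n.choose (n - m) * (((n - m : ℕ) : ℝ) / n) ^ (m * 768) ≤
      (1 / 4) ^ n := by
  have hn' : (0 : ℝ) < n := by exact_mod_cast hn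
  have hx : ((n - m : ℕ) : ℝ) / n ≤ 15 / 16 := by
    rw [div_le_iff₀ hn', Nat.cast_sub hmn]
    have : (n : ℝ) ≤ ((16 * m : ℕ) : ℝ) := by exact_mod_cast hm
    push_cast at this
    linarith
  have hc : ∀ t, (n.choose t : ℝ) ≤ 2 ^ n := fun t => by
    exact_mod_cast Nat.choose_le_two_pow n t
  calc (n.choose m : ℝ) * n.choose (n - m) * (((n - m : ℕ) : ℝ) / n) ^ (m * 768)
      ≤ 2 ^ n * 2 ^ n * (15 / 16) ^ (m * 768) := by
        gcongr
        · exact hc _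
        · exact hc _
    _ ≤ 2 ^ n * 2 ^ n * (15 / 16) ^ (48 * n) := by
        gcongr 2 ^ n * 2 ^ n * ?_
        exact pow_le_pow_of_le_one (by norm_num) (by norm_num) (by omega)
    _ = (2 * 2 * (15 / 16) ^ 48) ^ n := by rw [pow_mul, ← mul_pow, ← mul_pow]
    _ ≤ (1 / 4) ^ n := by gcongr; norm_num

theorem sum_Icc_one_quarter_pow_le (M : ℕ) :
    ∑ s ∈ Icc 1 M, (1 / 4 : ℝ) ^ s ≤ 1 / 3 - (1 / 4) ^ M / 3 := by
  induction M with
  | zero => simp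
  | succ M ih =>
    rw [sum_Icc_succ_top (by omega)]
    rw [pow_succ]
    linarith

theorem exists_perms_expanding {n : ℕ} (hn : 8 ≤ n) :
    ∃ σ : Fin 768 → Equiv.Perm (Fin n), ∀ S T : Finset (Fin n),
      (1 ≤ S.card ∧ 4 * S.card ≤ n ∧ T.card = 2 * S.card) ∨
        (S.card = n / 8 ∧ T.card = n - n / 8) →
      ∃ i, ∃ v ∈ S, σ i v ∉ T := by
  obtain ⟨σ, hσ⟩ := exists_perms_not_mapsTo (n := n) (k := 768) (by omega)
    ((Icc 1 (n / 4)).image (fun s => (s, 2 * s)) ∪ {(n / 8, n - n / 8)}) (by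
      rw [sum_union (by
        simp only [disjoint_singleton_right, mem_image, mem_Icc, Prod.mk.injEq, not_exists]
        omega), sum_image (by simp), sum_singleton]
      have h₁ : ∑ s ∈ Icc 1 (n / 4), (n.choose s : ℝ) * n.choose (2 * s) *
          (((2 * s : ℕ) : ℝ) / n) ^ (s * 768) ≤ ∑ s ∈ Icc 1 (n / 4), (1 / 4 : ℝ) ^ s :=
        sum_le_sum fun s hs => choose_mul_choose_two_mul_le (by omega)
          (by rw [mem_Icc] at hs; omega) (by norm_num)
      have h₂ := sum_Icc_one_quarter_pow_le (n / 4)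
      have h₃ := choose_mul_choose_sub_le (n := n) (m := n / 8) (by omega) (by omega) (by omega)
      have h₄ : (1 / 4 : ℝ) ^ n ≤ 1 / 4 :=
        pow_le_of_le_one (by norm_num) (by norm_num) (by omega)
      have h₅ : (0 : ℝ) < (1 / 4) ^ (n / 4) := by positivity
      linarith)
  refine ⟨σ, fun S T h => hσ S T ?_⟩
  simp only [mem_union, mem_image, mem_Icc, mem_singleton, Prod.mk.injEq]
  rcases h with ⟨h₁, h₂, h₃⟩ | ⟨h₁, h₂⟩
  · exact Or.inl ⟨S.card, by omega, rfl, h₃.symm⟩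
  · exact Or.inr ⟨h₁, h₂⟩

/-- The graph joining each vertex to its distinct images under a family of permutations. -/
def permGraph {n k : ℕ} (σ : Fin k → Equiv.Perm (Fin n)) : SimpleGraph (Fin n) :=
  SimpleGraph.fromRel fun u v => ∃ i, σ i u = v

theorem permGraph_adj {n k : ℕ} {σ : Fin k → Equiv.Perm (Fin n)} {u : Fin n} {i : Fin k}
    (h : u ≠ σ i u) : (permGraph σ).Adj u (σ i u) :=
  (SimpleGraph.fromRel_adj _ _ _).2 ⟨h, Or.inl ⟨i, rfl⟩⟩

theorem degree_permGraph_le {n k : ℕ} (σ : Fin k → Equiv.Perm (Fin n)) (v : Fin n) :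
    (permGraph σ).degree v ≤ 2 * k := by
  have hsub : (permGraph σ).neighborFinset v ⊆
      (univ.image fun i => σ i v) ∪ univ.image fun i => (σ i).symm v := by
    intro w hw
    rw [SimpleGraph.mem_neighborFinset, permGraph, SimpleGraph.fromRel_adj] at hw
    simp only [mem_union, mem_image, mem_univ, true_and]
    refine hw.2.imp id ?_
    rintro ⟨i, rfl⟩
    exact ⟨i, by simp⟩
  calc (permGraph σ).degree v ≤ _ := card_le_card hsub
    _ ≤ _ := card_union_le _ _
    _ ≤ k + k := add_le_add (card_image_le.trans (by simp)) (card_image_le.trans (by simp))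
    _ = 2 * k := by ring

theorem card_sub_lt_card_edges {n k m : ℕ} {σ : Fin k → Equiv.Perm (Fin n)}
    (hσ : ∀ S T : Finset (Fin n), S.card = m → T.card = n - m → ∃ i, ∃ v ∈ S, σ i v ∉ T)
    {S B : Finset (Fin n)} (hSB : Disjoint S B) (hB : m ≤ B.card) :
    S.card < m + (univ.filter fun e : Fin n × Fin n =>
      (permGraph σ).Adj e.1 e.2 ∧ e.1 ∈ S ∧ e.2 ∈ B).card := by
  obtain ⟨B', hB', hcard⟩ := exists_subset_card_eq hB
  have hisolated : (S.filter fun v => ∀ i, σ i v ∉ B').card < m := by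
    by_contra! h
    obtain ⟨A, hA, hAcard⟩ := exists_subset_card_eq h
    obtain ⟨i, v, hv, hiv⟩ := hσ A B'ᶜ hAcard (by rw [card_compl, Fintype.card_fin, hcard])
    exact (mem_filter.1 (hA hv)).2 i (by simpa using hiv)
  have hcovered : (S.filter fun v => ¬ ∀ i, σ i v ∉ B') ⊆
      (univ.filter fun e : Fin n × Fin n =>
        (permGraph σ).Adj e.1 e.2 ∧ e.1 ∈ S ∧ e.2 ∈ B).image Prod.fst := by
    intro v hv
    simp only [mem_filter, not_forall, not_not] at hv
    obtain ⟨hvS, i, hi⟩ := hv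
    refine mem_image.2 ⟨(v, σ i v), ?_, rfl⟩
    simp only [mem_filter, mem_univ, true_and]
    exact ⟨permGraph_adj fun e => disjoint_left.1 hSB hvS (e ▸ hB' hi), hvS, hB' hi⟩
  have h₁ := (card_le_card hcovered).trans card_image_le
  have h₂ := card_filter_add_card_filter_not (s := S) fun v => ∀ i, σ i v ∉ B'
  omega

theorem card_le_card_edges_permGraph {n k : ℕ} {σ : Fin k → Equiv.Perm (Fin n)}
    (hσ : ∀ S T : Finset (Fin n),
      (1 ≤ S.card ∧ 4 * S.card ≤ n ∧ T.card = 2 * S.card) ∨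
        (S.card = n / 8 ∧ T.card = n - n / 8) →
      ∃ i, ∃ v ∈ S, σ i v ∉ T)
    {S : Finset (Fin n)} (hS : 2 * S.card ≤ n) :
    S.card ≤ (univ.filter fun e : Fin n × Fin n =>
      (permGraph σ).Adj e.1 e.2 ∧ e.1 ∈ S ∧ e.2 ∉ S).card := by
  rcases Nat.eq_zero_or_pos S.card with h₀ | h₀
  · omega
  rcases le_or_gt (4 * S.card) n with hsmall | hlarge
  · set N : Finset (Fin n) := univ.biUnion fun i => S.image (σ i) with hN
    have hNcard : 2 * S.card ≤ N.card := by
      by_contra! h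
      obtain ⟨T, hNT, hT⟩ := exists_superset_card_eq h.le (by rw [Fintype.card_fin]; omega)
      obtain ⟨i, v, hv, hiv⟩ := hσ S T (Or.inl ⟨h₀, hsmall, hT⟩)
      exact hiv (hNT (mem_biUnion.2 ⟨i, mem_univ _, mem_image_of_mem _ hv⟩))
    have hsub : N \ S ⊆ (univ.filter fun e : Fin n × Fin n =>
        (permGraph σ).Adj e.1 e.2 ∧ e.1 ∈ S ∧ e.2 ∉ S).image Prod.snd := by
      intro w hw
      simp only [hN, mem_sdiff, mem_biUnion, mem_univ, true_and, mem_image] at hw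
      obtain ⟨⟨i, v, hv, rfl⟩, hw⟩ := hw
      refine mem_image.2 ⟨(v, σ i v), ?_, rfl⟩
      simp only [mem_filter, mem_univ, true_and]
      exact ⟨permGraph_adj fun e => hw (e ▸ hv), hv, hw⟩
    have h₁ := (card_le_card hsub).trans card_image_le
    have h₂ := le_card_sdiff S N
    omega
  · have hcompl : Sᶜ.card = n - S.card := by rw [card_compl, Fintype.card_fin]
    obtain ⟨B, hB, hBcard⟩ := exists_subset_card_eq (s := Sᶜ) (n := n / 8) (by omega)
    have hdiff : (Sᶜ \ B).card = n - S.card - n / 8 := by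
      rw [card_sdiff_of_subset hB, hcompl, hBcard]
    have hσ' := fun (A T : Finset (Fin n)) hA hT => hσ A T (Or.inr ⟨hA, hT⟩)
    have hS' : Disjoint S Sᶜ := _root_.disjoint_compl_right
    have h₁ := card_sub_lt_card_edges hσ' (hS'.mono_right hB) hBcard.ge
    have h₂ := card_sub_lt_card_edges hσ'
      (hS'.mono_right (sdiff_subset (t := B)))
      (by omega)
    have hdisj : Disjoint
        (univ.filter fun e : Fin n × Fin n =>
          (permGraph σ).Adj e.1 e.2 ∧ e.1 ∈ S ∧ e.2 ∈ B)
        (univ.filter fun e : Fin n × Fin n =>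
          (permGraph σ).Adj e.1 e.2 ∧ e.1 ∈ S ∧ e.2 ∈ Sᶜ \ B) := by
      rw [disjoint_filter]
      rintro e - ⟨-, -, h⟩ ⟨-, -, h'⟩
      exact (mem_sdiff.1 h').2 h
    have hsub : (univ.filter fun e : Fin n × Fin n =>
          (permGraph σ).Adj e.1 e.2 ∧ e.1 ∈ S ∧ e.2 ∈ B) ∪
        (univ.filter fun e : Fin n × Fin n =>
          (permGraph σ).Adj e.1 e.2 ∧ e.1 ∈ S ∧ e.2 ∈ Sᶜ \ B) ⊆
        univ.filter fun e : Fin n × Fin n =>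
          (permGraph σ).Adj e.1 e.2 ∧ e.1 ∈ S ∧ e.2 ∉ S := by
      refine union_subset ?_ ?_ <;> refine monotone_filter_right _ ?_ <;>
        rintro e - ⟨h, hS, hB'⟩
      · exact ⟨h, hS, mem_compl.1 (hB hB')⟩
      · exact ⟨h, hS, mem_compl.1 (mem_sdiff.1 hB').1⟩
    have h₃ := card_le_card hsub
    rw [card_union_of_disjoint hdisj] at h₃
    omega

theorem card_le_card_edges_top {n : ℕ} {S : Finset (Fin n)} (hS : 2 * S.card ≤ n) :
    S.card ≤ (univ.filter fun e : Fin n × Fin n =>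
      (⊤ : SimpleGraph (Fin n)).Adj e.1 e.2 ∧ e.1 ∈ S ∧ e.2 ∉ S).card := by
  have hsub : S ×ˢ Sᶜ ⊆ univ.filter fun e : Fin n × Fin n =>
      (⊤ : SimpleGraph (Fin n)).Adj e.1 e.2 ∧ e.1 ∈ S ∧ e.2 ∉ S := by
    intro e he
    rw [mem_product, mem_compl] at he
    simp only [mem_filter, mem_univ, true_and, SimpleGraph.top_adj]
    exact ⟨fun h => he.2 (h ▸ he.1), he⟩
  refine le_trans ?_ (card_le_card hsub)
  rw [card_product, card_compl, Fintype.card_fin]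
  rcases Nat.eq_zero_or_pos S.card with h | h
  · omega
  · exact Nat.le_mul_of_pos_right _ (by omega)

/-- There is a constant `d` such that for every `n ≥ 1` there exists a
finite simple graph `G` on `n` vertices with maximum degree at most `d` and expansion
at least `1`: for every vertex subset `S` with `|S| ≤ n/2`, the number of edges of `G`
with exactly one endpoint in `S` (counted here as ordered pairs `(u,v)` with `u ∈ S`,
`v ∉ S`, `G.Adj u v`, which counts each crossing edge exactly once) is at least `|S|`. -/
theorem exists_bounded_degree_expander :
    ∃ d : ℕ, ∀ n : ℕ, 1 ≤ n → ∃ G : SimpleGraph (Fin n),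
      (∀ v : Fin n, G.degree v ≤ d) ∧
      ∀ S : Finset (Fin n), 2 * S.card ≤ n →
        S.card ≤ (Finset.univ.filter fun e : Fin n × Fin n =>
          G.Adj e.1 e.2 ∧ e.1 ∈ S ∧ e.2 ∉ S).card := by
  refine ⟨2 * 768, fun n _ => ?_⟩
  rcases lt_or_ge n 8 with hn | hn
  · refine ⟨⊤, fun v => ?_, fun S hS => by convert card_le_card_edges_top hS⟩
    refine (card_le_univ _).trans ?_
    rw [Fintype.card_fin]
    omega
  · obtain ⟨σ, hσ⟩ := exists_perms_expanding hn
    exact ⟨permGraph σ, degree_permGraph_le σ, fun S => card_le_card_edges_permGraph hσ⟩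
end

section
/- (0-1 Principle) Let X_1,…,X_n be {0,1}-valued random variables on a common probability space such that ∑_{i=1}^n X_i ≤ 1 almost surely. Then X_1,…,X_n are negatively associated. -/
open MeasureTheory ProbabilityTheory

/-- A family of (bounded) real random variables `X` is *negatively associated* if for
all disjoint index sets `I, J` and all bounded measurable coordinatewise non-decreasing
functions `f`, `g` depending only on the coordinates in `I` resp. `J`, we have
`E[f(X)·g(X)] ≤ E[f(X)]·E[g(X)]`. -/
def NegAssoc {Ω : Type*} [MeasurableSpace Ω] (μ : Measure Ω) {ι : Type*}
    (X : ι → Ω → ℝ) : Prop :=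
  ∀ I J : Set ι, Disjoint I J →
    ∀ f g : (ι → ℝ) → ℝ,
      Measurable f → Measurable g → Monotone f → Monotone g →
      (∃ C, ∀ v, |f v| ≤ C) → (∃ C, ∀ v, |g v| ≤ C) →
      (∀ v v', (∀ k ∈ I, v k = v' k) → f v = f v') →
      (∀ v v', (∀ k ∈ J, v k = v' k) → g v = g v') →
      ∫ ω, f (fun k => X k ω) * g (fun k => X k ω) ∂μ ≤
        (∫ ω, f (fun k => X k ω) ∂μ) * ∫ ω, g (fun k => X k ω) ∂μ

/-- If `F ≥ a`, `G ≥ b` and at each point one of these bounds is attained, then `F` and `G` are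
nonpositively correlated. -/
theorem integral_mul_le_of_eq_lower_bound {Ω : Type*} [MeasurableSpace Ω] {μ : Measure Ω}
    [IsProbabilityMeasure μ] {F G : Ω → ℝ} {a b : ℝ} (hF : Integrable F μ) (hG : Integrable G μ)
    (ha : ∀ᵐ ω ∂μ, a ≤ F ω) (hb : ∀ᵐ ω ∂μ, b ≤ G ω) (h : ∀ᵐ ω ∂μ, F ω = a ∨ G ω = b) :
    ∫ ω, F ω * G ω ∂μ ≤ (∫ ω, F ω ∂μ) * ∫ ω, G ω ∂μ := by
  have hprod : ∫ ω, F ω * G ω ∂μ = ∫ ω, (b * F ω + a * G ω - a * b) ∂μ := by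
    refine integral_congr_ae ?_
    filter_upwards [h] with ω hω
    rcases hω with hω | hω <;> rw [hω] <;> ring
  rw [hprod, integral_sub (by fun_prop) (integrable_const _),
    integral_add (hF.const_mul b) (hG.const_mul a), integral_const_mul, integral_const_mul]
  have hFa : a ≤ ∫ ω, F ω ∂μ := by
    simpa using integral_mono_ae (integrable_const a) hF ha
  have hGb : b ≤ ∫ ω, G ω ∂μ := by
    simpa using integral_mono_ae (integrable_const b) hG hb
  simp only [integral_const, probReal_univ, one_smul]
  nlinarith [mul_nonneg (sub_nonneg.2 hFa) (sub_nonneg.2 hGb)]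

/-- A `{0,1}`-valued family with sum at most `1` vanishes on one of any two disjoint sets. -/
theorem eq_zero_on_or_eq_zero_on_of_sum_le_one {ι : Type*} [Fintype ι] {x : ι → ℝ}
    (h01 : ∀ i, x i = 0 ∨ x i = 1) (hsum : ∑ i, x i ≤ 1) {I J : Set ι} (hIJ : Disjoint I J) :
    (∀ k ∈ I, x k = 0) ∨ ∀ k ∈ J, x k = 0 := by
  by_contra! ⟨⟨i, hi, hxi⟩, ⟨j, hj, hxj⟩⟩
  have hle := Finset.add_le_sum (f := x) (s := Finset.univ)
    (fun k _ => by rcases h01 k with hk | hk <;> simp [hk])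
    (Finset.mem_univ i) (Finset.mem_univ j) (hIJ.ne_of_mem hi hj)
  rw [(h01 i).resolve_left hxi, (h01 j).resolve_left hxj] at hle
  linarith

/-- 0-1 Principle: if `X_1, …, X_n` are `{0,1}`-valued random variables
with `∑ i, X i ≤ 1` almost surely, then they are negatively associated. -/
theorem zero_one_principle {Ω : Type*} [MeasurableSpace Ω] (μ : Measure Ω)
    [IsProbabilityMeasure μ] {n : ℕ} (X : Fin n → Ω → ℝ)
    (hmeas : ∀ i, Measurable (X i))
    (h01 : ∀ i, ∀ᵐ ω ∂μ, X i ω = 0 ∨ X i ω = 1)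
    (hsum : ∀ᵐ ω ∂μ, ∑ i, X i ω ≤ 1) :
    NegAssoc μ X := by
  rintro I J hIJ f g hf hg hfm hgm ⟨C, hC⟩ ⟨D, hD⟩ hfI hgJ
  have hX : Measurable fun ω k => X k ω := measurable_pi_lambda _ hmeas
  have h01' : ∀ᵐ ω ∂μ, ∀ i, X i ω = 0 ∨ X i ω = 1 := ae_all_iff.2 h01
  have hnonneg : ∀ᵐ ω ∂μ, (0 : Fin n → ℝ) ≤ fun k => X k ω := by
    filter_upwards [h01'] with ω hω k
    rcases hω k with hk | hk <;> simp [hk]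
  refine integral_mul_le_of_eq_lower_bound (a := f 0) (b := g 0)
    (.of_bound (hf.comp hX).aestronglyMeasurable C (ae_of_all _ fun ω => hC _))
    (.of_bound (hg.comp hX).aestronglyMeasurable D (ae_of_all _ fun ω => hD _))
    (hnonneg.mono fun ω hω => hfm hω) (hnonneg.mono fun ω hω => hgm hω) ?_
  filter_upwards [h01', hsum] with ω hω hs
  exact (eq_zero_on_or_eq_zero_on_of_sum_le_one hω hs hIJ).imp (hfI _ _) (hgJ _ _)
end

section
/- Let p_t ∈ [0,1] for t ∈ {1,…,n} and let w_{i,t} ≥ 0 for i ∈ {1,…,m}, t ∈ {1,…,n}. Let A_1,…,A_n be events on a probability space with P(A_t) = p_t, and let M_{i,t} (i ∈ {1,…,m}, t ∈ {1,…,n}) be {0,1}-valued random variables on the same space such that almost surely ∑_{t=1}^n M_{i,t} ≤ 1 for every i and ∑_{i=1}^m M_{i,t} ≤ 1_{A_t} for every t, and such that for every t the indicator 1_{A_t} is independent of the family (M_{i,t'})_{i∈{1,…,m}, t'<t}. Then the vector x_{i,t} := E[M_{i,t}] is a feasible solution of LP-Match; consequently, E[∑_{i,t} w_{i,t}·M_{i,t}]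 is at most the optimal value of LP-Match. -/
open MeasureTheory ProbabilityTheory Finset

/-- Feasibility for LP-Match: `x` is nonnegative, every bin is fractionally matched at
most once, every ball `t` is fractionally matched with probability at most `p t`, and
`x i t ≤ p t · (1 − ∑_{t' < t} x i t')`. -/
def LPMatchFeasible {m n : ℕ} (p : Fin n → ℝ) (x : Fin m → Fin n → ℝ) : Prop :=
  (∀ i t, 0 ≤ x i t) ∧
  (∀ i, ∑ t, x i t ≤ 1) ∧
  (∀ t, ∑ i, x i t ≤ p t) ∧
  (∀ i t, x i t ≤ p t *
    (1 - ∑ t' ∈ Finset.univ.filter fun t' : Fin n => t' < t, x i t'))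

theorem integrable_of_forall_zero_or_one {Ω : Type*} [MeasurableSpace Ω] (μ : Measure Ω)
    [IsFiniteMeasure μ] {f : Ω → ℝ} (hf : Measurable f) (h01 : ∀ ω, f ω = 0 ∨ f ω = 1) :
    Integrable f μ :=
  Integrable.of_bound hf.aestronglyMeasurable 1 <| .of_forall fun ω => by
    rcases h01 ω with h | h <;> simp [h]

/-- The objective of LP-Match with nonnegative weights is bounded on the feasible region. -/
theorem bddAbove_LPMatch_values {m n : ℕ} (p : Fin n → ℝ) (w : Fin m → Fin n → ℝ)
    (hw : ∀ i t, 0 ≤ w i t) :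
    BddAbove {v : ℝ | ∃ x : Fin m → Fin n → ℝ,
      LPMatchFeasible p x ∧ v = ∑ i, ∑ t, w i t * x i t} := by
  refine ⟨∑ i, ∑ t, w i t, ?_⟩
  rintro v ⟨x, ⟨hx, hrow, -, -⟩, rfl⟩
  exact sum_le_sum fun i _ => sum_le_sum fun t _ => mul_le_of_le_one_right (hw i t) <|
    (single_le_sum (f := x i) (fun t _ => hx i t) (mem_univ t)).trans (hrow i)

/-- Let `p_t ∈ [0,1]`, `w_{i,t} ≥ 0`, let `A_t` be events with
`P(A_t) = p_t` and let `M_{i,t}` be `{0,1}`-valued random variables such that a.s.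
`∑_t M_{i,t} ≤ 1` for every `i` and `∑_i M_{i,t} ≤ 1_{A_t}` for every `t`, and such
that for every `t` the indicator `1_{A_t}` is independent of the family
`(M_{i,t'})_{i, t' < t}`. Then `x_{i,t} := E[M_{i,t}]` is feasible for LP-Match;
consequently `E[∑_{i,t} w_{i,t} M_{i,t}]` is at most the optimal value of LP-Match. -/
theorem expected_matching_feasible_for_LPMatch
    {Ω : Type*} [MeasurableSpace Ω] (μ : Measure Ω) [IsProbabilityMeasure μ]
    {m n : ℕ} (p : Fin n → ℝ) (w : Fin m → Fin n → ℝ)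
    (hp : ∀ t, 0 ≤ p t ∧ p t ≤ 1) (hw : ∀ i t, 0 ≤ w i t)
    (A : Fin n → Set Ω) (hA : ∀ t, MeasurableSet (A t))
    (hAp : ∀ t, (μ (A t)).toReal = p t)
    (M : Fin m → Fin n → Ω → ℝ)
    (hMmeas : ∀ i t, Measurable (M i t))
    (hM01 : ∀ i t ω, M i t ω = 0 ∨ M i t ω = 1)
    (hrow : ∀ i, ∀ᵐ ω ∂μ, ∑ t, M i t ω ≤ 1)
    (hcol : ∀ t, ∀ᵐ ω ∂μ, ∑ i, M i t ω ≤ (A t).indicator (fun _ => (1 : ℝ)) ω)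
    (hindep : ∀ t : Fin n,
      IndepFun ((A t).indicator (fun _ => (1 : ℝ)))
        (fun ω (e : {e : Fin m × Fin n // e.2 < t}) => M e.1.1 e.1.2 ω) μ) :
    LPMatchFeasible p (fun i t => ∫ ω, M i t ω ∂μ) ∧
      ∫ ω, ∑ i, ∑ t, w i t * M i t ω ∂μ ≤
        sSup {v : ℝ | ∃ x : Fin m → Fin n → ℝ,
          LPMatchFeasible p x ∧ v = ∑ i, ∑ t, w i t * x i t} := by
  have hnn : ∀ i t ω, 0 ≤ M i t ω := fun i t ω => by
    rcases hM01 i t ω with h | h <;> simp [h]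
  have hint : ∀ i t, Integrable (M i t) μ := fun i t =>
    integrable_of_forall_zero_or_one μ (hMmeas i t) (hM01 i t)
  have hintA : ∀ t, Integrable ((A t).indicator fun _ => (1 : ℝ)) μ := fun t =>
    (integrable_const 1).indicator (hA t)
  have hEA : ∀ t, ∫ ω, (A t).indicator (fun _ => (1 : ℝ)) ω ∂μ = p t := fun t => by
    rw [integral_indicator_const _ (hA t), smul_eq_mul, mul_one, ← hAp t, measureReal_def]
  have hfeas : LPMatchFeasible p (fun i t => ∫ ω, M i t ω ∂μ) := by
    refine ⟨fun i t => integral_nonneg (hnn i t), fun i => ?_, fun t => ?_, fun i t => ?_⟩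
    · rw [← integral_finsetSum _ fun t _ => hint i t]
      simpa using integral_mono_ae (integrable_finsetSum _ fun t _ => hint i t)
        (integrable_const (1 : ℝ)) (hrow i)
    · rw [← integral_finsetSum _ fun i _ => hint i t, ← hEA t]
      exact integral_mono_ae (integrable_finsetSum _ fun i _ => hint i t) (hintA t) (hcol t)
    · set past : Finset (Fin n) := univ.filter fun t' => t' < t with hpast
      have hintS : Integrable (fun ω => 1 - ∑ t' ∈ past, M i t' ω) μ :=
        (integrable_const 1).sub (integrable_finsetSum _ fun t' _ => hint i t')
      have hind : IndepFun ((A t).indicator fun _ => (1 : ℝ))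
          (fun ω => 1 - ∑ t' ∈ past, M i t' ω) μ := by
        have hg : Measurable fun f : {e : Fin m × Fin n // e.2 < t} → ℝ =>
            1 - ∑ t' ∈ past.attach, f ⟨(i, t'.1), (mem_filter.1 t'.2).2⟩ := by
          fun_prop
        refine ((hindep t).comp measurable_id hg).congr .rfl (.of_forall fun ω => ?_)
        exact congrArg (1 - ·) (sum_attach past fun t' => M i t' ω)
      have hE : ∫ ω, (A t).indicator (fun _ => (1 : ℝ)) ω * (1 - ∑ t' ∈ past, M i t' ω) ∂μ =
          p t * (1 - ∑ t' ∈ past, ∫ ω, M i t' ω ∂μ) := by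
        rw [hind.integral_fun_mul_eq_mul_integral (hintA t).aestronglyMeasurable
          hintS.aestronglyMeasurable, hEA t, integral_sub (integrable_const 1)
          (integrable_finsetSum _ fun t' _ => hint i t'),
          integral_finsetSum _ fun t' _ => hint i t']
        simp
      rw [← hE]
      refine integral_mono_ae (hint i t) (hind.integrable_mul (hintA t) hintS) ?_
      filter_upwards [hrow i, hcol t] with ω h1 h2
      have hle : M i t ω ≤ (A t).indicator (fun _ => (1 : ℝ)) ω :=
        (single_le_sum (f := fun j => M j t ω) (fun j _ => hnn j t ω) (mem_univ i)).trans h2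
      have hsum : M i t ω + ∑ t' ∈ past, M i t' ω ≤ 1 := by
        rw [← sum_insert (f := fun t' => M i t' ω) (by simp [hpast])]
        exact (sum_le_sum_of_subset_of_nonneg (subset_univ _) fun t' _ _ => hnn i t' ω).trans h1
      by_cases hω : ω ∈ A t
      · simp only [Set.indicator_of_mem hω]
        linarith
      · simpa [Set.indicator_of_notMem hω] using hle
  refine ⟨hfeas, le_csSup (bddAbove_LPMatch_values p w hw) ⟨_, hfeas, ?_⟩⟩
  rw [integral_finsetSum _ fun i _ => integrable_finsetSum _ fun t _ => (hint i t).const_mul _]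
  refine sum_congr rfl fun i _ => ?_
  rw [integral_finsetSum _ fun t _ => (hint i t).const_mul _]
  exact sum_congr rfl fun t _ => integral_const_mul _ _
end

section
/- In the rounding process with LP-feasible x, every edge (i,t) (i ∈ {1,…,m}, t ∈ {1,…,n}) satisfies P[(i,t) ∈ M] ≥ x_{i,t}·(1/2 + c). -/
open Finset

noncomputable section
open scoped Classical

namespace Rounding

/-- A configuration of all the randomness used by the rounding process: arrival
indicators `A_t`, first picks `I¹_t`, second picks `I²_t`, and acceptance coins
`Y_{i,t}`. -/
abbrev Cfg (m n : ℕ) :=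
  (Fin n → Bool) × (Fin n → Fin m) × (Fin n → Fin m) × (Fin m → Fin n → Bool)

/-- The constant `c = 1/100`. -/
def c : ℝ := 1 / 100

variable (m n : ℕ)

/-- `S x i t = ∑_{t' < t} x i t'`. -/
def S (x : Fin m → Fin n → ℝ) (i : Fin m) (t : Fin n) : ℝ :=
  ∑ t' ∈ Finset.univ.filter fun t' : Fin n => t' < t, x i t'

/-- LP-feasibility of `x` (with arrival probabilities `p t ∈ (0,1]`, every
constraint `∑_i x i t = p t` tight). -/
def LPFeasible (p : Fin n → ℝ) (x : Fin m → Fin n → ℝ) : Prop :=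
  (∀ t, 0 < p t ∧ p t ≤ 1) ∧
  (∀ i t, 0 ≤ x i t) ∧
  (∀ i, ∑ t, x i t ≤ 1) ∧
  (∀ t, ∑ i, x i t = p t) ∧
  (∀ i t, x i t ≤ p t * (1 - S m n x i t))

/-- Edge `(i,t)` is early if `∑_{t' < t} x i t' ≤ (1/2 − c)/(1/2 + c)`. -/
def Early (x : Fin m → Fin n → ℝ) (i : Fin m) (t : Fin n) : Prop :=
  S m n x i t ≤ (1/2 - c) / (1/2 + c)

/-- Edge `(i,t)` is late if it is not early. -/
def Late (x : Fin m → Fin n → ℝ) (i : Fin m) (t : Fin n) : Prop :=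
  ¬ Early m n x i t

/-- The acceptance probability `q_{i,t}`. -/
def q (x : Fin m → Fin n → ℝ) (i : Fin m) (t : Fin n) : ℝ :=
  min 1 ((1/2 + c) / (1 - (1/2 + c) * S m n x i t))

/-- The probability of a configuration: the product of the probabilities of all
the mutually independent components (`P(A_t = 1) = p_t`,
`P(I¹_t = i) = P(I²_t = i) = x_{i,t}/p_t`, `P(Y_{i,t} = 1) = q_{i,t}`). -/
def weight (p : Fin n → ℝ) (x : Fin m → Fin n → ℝ) (cfg : Cfg m n) : ℝ :=
  (∏ t, if cfg.1 t then p t else 1 - p t) *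
  (∏ t, x (cfg.2.1 t) t / p t) *
  (∏ t, x (cfg.2.2.1 t) t / p t) *
  ∏ i, ∏ t, if cfg.2.2.2 i t then q m n x i t else 1 - q m n x i t

/-- Probability of an event. -/
def Pr (p : Fin n → ℝ) (x : Fin m → Fin n → ℝ) (E : Set (Cfg m n)) : ℝ :=
  ∑ cfg : Cfg m n, if cfg ∈ E then weight m n p x cfg else 0

/-- Conditional probability of `E` given `F`. -/
def condPr (p : Fin n → ℝ) (x : Fin m → Fin n → ℝ) (E F : Set (Cfg m n)) : ℝ :=
  Pr m n p x (E ∩ F) / Pr m n p x F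

/-- Bin `i` is unmatched in the partial matching `M`. -/
def FreeBin (M : Finset (Fin m × Fin n)) (i : Fin m) : Prop :=
  ∀ t, (i, t) ∉ M

/-- `proc x cfg t = (M₁, M₂)`: the two parts of the matching built by the rounding
process after processing all times `< t`.  At each time `t`, if ball `t` arrives,
its first pick `I¹_t` is unmatched, and the coin `Y_{I¹_t,t}` comes up heads, then
`(I¹_t, t)` is added to `M₁`; otherwise, if ball `t` arrives, its second pick
`I²_t` is unmatched, and edge `(I²_t, t)` is late, then `(I²_t, t)` is added
to `M₂`. -/
def proc (x : Fin m → Fin n → ℝ) (cfg : Cfg m n) :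
    ℕ → Finset (Fin m × Fin n) × Finset (Fin m × Fin n)
  | 0 => (∅, ∅)
  | (t + 1) =>
    let P := proc x cfg t
    if h : t < n then
      let T : Fin n := ⟨t, h⟩
      let M := P.1 ∪ P.2
      if cfg.1 T = true ∧ FreeBin m n M (cfg.2.1 T) ∧ cfg.2.2.2 (cfg.2.1 T) T = true then
        (insert (cfg.2.1 T, T) P.1, P.2)
      else if cfg.1 T = true ∧ FreeBin m n M (cfg.2.2.1 T) ∧ Late m n x (cfg.2.2.1 T) T then
        (P.1, insert (cfg.2.2.1 T, T) P.2)
      else P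
    else P

/-- The final matching `M₁` (edges matched on a first pick). -/
def M1F (x : Fin m → Fin n → ℝ) (cfg : Cfg m n) : Finset (Fin m × Fin n) :=
  (proc m n x cfg n).1

/-- The final matching `M₂` (edges matched on a second pick). -/
def M2F (x : Fin m → Fin n → ℝ) (cfg : Cfg m n) : Finset (Fin m × Fin n) :=
  (proc m n x cfg n).2

/-- The final matching `M = M₁ ∪ M₂`. -/
def MF (x : Fin m → Fin n → ℝ) (cfg : Cfg m n) : Finset (Fin m × Fin n) :=
  M1F m n x cfg ∪ M2F m n x cfg

/-- `V_{i,t}`: the event that bin `i` is unmatched before time `t`. -/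
def V (x : Fin m → Fin n → ℝ) (i : Fin m) (t : Fin n) : Set (Cfg m n) :=
  {cfg | FreeBin m n ((proc m n x cfg t.1).1 ∪ (proc m n x cfg t.1).2) i}

/-- `O_{i,t}`: the event that bin `i` is matched before time `t`. -/
def O (x : Fin m → Fin n → ℝ) (i : Fin m) (t : Fin n) : Set (Cfg m n) :=
  (V m n x i t)ᶜ

/-- `O^E_{i,t}`: the event that bin `i` is matched along an early edge before time `t`. -/
def OE (x : Fin m → Fin n → ℝ) (i : Fin m) (t : Fin n) : Set (Cfg m n) :=
  {cfg | ∃ t' : Fin n, Early m n x i t' ∧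
    (i, t') ∈ (proc m n x cfg t.1).1 ∪ (proc m n x cfg t.1).2}

/-- `O^L_{i,t}`: the event that bin `i` is matched along a late edge before time `t`. -/
def OL (x : Fin m → Fin n → ℝ) (i : Fin m) (t : Fin n) : Set (Cfg m n) :=
  {cfg | ∃ t' : Fin n, Late m n x i t' ∧
    (i, t') ∈ (proc m n x cfg t.1).1 ∪ (proc m n x cfg t.1).2}

/-- `U₁(t)`: the event that ball `t` is not matched in the first-pick step at time `t`. -/
def U1 (x : Fin m → Fin n → ℝ) (t : Fin n) : Set (Cfg m n) :=
  {cfg | ∀ i, (i, t) ∉ (proc m n x cfg (t.1 + 1)).1}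

/-- The event that ball `t` arrives (`A_t = 1`). -/
def EvA (t : Fin n) : Set (Cfg m n) := {cfg | cfg.1 t = true}

/-- The event that the first pick of ball `t` is bin `j` (`I¹_t = j`). -/
def EvI1 (j : Fin m) (t : Fin n) : Set (Cfg m n) := {cfg | cfg.2.1 t = j}


theorem prod_mul_eq_prod_mul {ι : Type*} [Fintype ι] (F G : ι → ℝ) (i : ι) (a b : ℝ)
    (hne : ∀ j, j ≠ i → F j = G j) (hi : F i * a = G i * b) :
    (∏ j, F j) * a = (∏ j, G j) * b := by
  rw [← Finset.mul_prod_erase univ F (mem_univ i), ← Finset.mul_prod_erase univ G (mem_univ i),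
    Finset.prod_congr rfl fun j hj => hne j (Finset.ne_of_mem_erase hj)]
  linear_combination (∏ j ∈ univ.erase i, G j) * hi

/-- A coordinate `X` whose value can be exchanged for a fresh one of law `ν` without changing the
joint weight is independent of every function that ignores it. -/
theorem sum_mul_eq_of_exchange {Ω β : Type*} [Fintype Ω] [Fintype β] (w : Ω → ℝ) (X : Ω → β)
    (u : Ω → β → Ω) (ν : β → ℝ) (hXu : ∀ ω b, X (u ω b) = b) (huu : ∀ ω b, u (u ω b) (X ω) = ω)
    (hw : ∀ ω b, w (u ω b) * ν (X ω) = w ω * ν b) (hν : ∑ b, ν b = 1)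
    (h : Ω → ℝ) (hh : ∀ ω b, h (u ω b) = h ω) (φ : β → ℝ) :
    ∑ ω, w ω * (h ω * φ (X ω)) = (∑ ω, w ω * h ω) * ∑ b, ν b * φ b := by
  have hinv : Function.Involutive fun z : Ω × β => (u z.1 z.2, X z.1) := by
    rintro ⟨ω, b⟩
    simp [hXu, huu]
  calc ∑ ω, w ω * (h ω * φ (X ω))
      = ∑ z : Ω × β, w z.1 * ν z.2 * (h z.1 * φ (X z.1)) := by
        rw [Fintype.sum_prod_type]
        refine Finset.sum_congr rfl fun ω _ => ?_
        dsimp only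
        rw [← Finset.sum_mul, ← Finset.mul_sum, hν, mul_one]
    _ = ∑ z : Ω × β, w z.1 * ν z.2 * (h z.1 * φ z.2) := by
        rw [← Equiv.sum_comp hinv.toPerm]
        refine Finset.sum_congr rfl fun z _ => ?_
        simp only [Function.Involutive.coe_toPerm]
        rw [hw, hh, hXu]
    _ = _ := by
        rw [Fintype.sum_prod_type, Finset.sum_mul_sum]
        exact Finset.sum_congr rfl fun ω _ => Finset.sum_congr rfl fun b _ => by ring

theorem sum_mul_mul_mul {α β γ δ : Type*} [Fintype α] [Fintype β] [Fintype γ] [Fintype δ]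
    (f : α → ℝ) (g : β → ℝ) (h : γ → ℝ) (k : δ → ℝ) :
    ∑ a, ∑ b, ∑ c, ∑ d, f a * g b * h c * k d =
      (∑ a, f a) * (∑ b, g b) * (∑ c, h c) * ∑ d, k d := by
  simp only [← Finset.mul_sum, ← Finset.sum_mul]

variable {m n}

/-- Expectation over the randomness of the rounding process. -/
def expect (p : Fin n → ℝ) (x : Fin m → Fin n → ℝ) (f : Cfg m n → ℝ) : ℝ :=
  ∑ cfg, weight m n p x cfg * f cfg

/-- The indicator that ball `t` arrives. -/
def arr (t : Fin n) (cfg : Cfg m n) : ℝ := if cfg.1 t then 1 else 0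

/-- The indicator that the first pick of ball `t` is bin `j`. -/
def pick1 (t : Fin n) (j : Fin m) (cfg : Cfg m n) : ℝ := if cfg.2.1 t = j then 1 else 0

/-- The indicator that the second pick of ball `t` is bin `j`. -/
def pick2 (t : Fin n) (j : Fin m) (cfg : Cfg m n) : ℝ := if cfg.2.2.1 t = j then 1 else 0

/-- The indicator that the acceptance coin of edge `(j, t)` comes up heads. -/
def coin (t : Fin n) (j : Fin m) (cfg : Cfg m n) : ℝ := if cfg.2.2.2 j t then 1 else 0

/-- A function of the randomness before time `t`. -/
def Past (t : ℕ) (h : Cfg m n → ℝ) : Prop :=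
  ∀ cfg cfg' : Cfg m n, (∀ s : Fin n, s.1 < t → cfg.1 s = cfg'.1 s ∧ cfg.2.1 s = cfg'.2.1 s ∧
    cfg.2.2.1 s = cfg'.2.2.1 s ∧ ∀ i, cfg.2.2.2 i s = cfg'.2.2.2 i s) → h cfg = h cfg'

section Expectation

variable {p : Fin n → ℝ} {x : Fin m → Fin n → ℝ}

theorem expect_add (f g : Cfg m n → ℝ) :
    expect p x (fun cfg => f cfg + g cfg) = expect p x f + expect p x g := by
  simp only [expect, mul_add, Finset.sum_add_distrib]

theorem expect_sub (f g : Cfg m n → ℝ) :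
    expect p x (fun cfg => f cfg - g cfg) = expect p x f - expect p x g := by
  simp only [expect, mul_sub, Finset.sum_sub_distrib]

theorem expect_const_mul (a : ℝ) (f : Cfg m n → ℝ) :
    expect p x (fun cfg => a * f cfg) = a * expect p x f := by
  simp only [expect, Finset.mul_sum]
  exact Finset.sum_congr rfl fun _ _ => by ring

theorem expect_sum {ι : Type*} (s : Finset ι) (f : ι → Cfg m n → ℝ) :
    expect p x (fun cfg => ∑ j ∈ s, f j cfg) = ∑ j ∈ s, expect p x (f j) := by
  simp only [expect, Finset.mul_sum]
  exact Finset.sum_comm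

theorem expect_mul_arr (h : Cfg m n → ℝ) (t : Fin n)
    (hh : ∀ cfg b, h (Function.update cfg.1 t b, cfg.2) = h cfg) :
    expect p x (fun cfg => h cfg * arr t cfg) = expect p x h * p t := by
  have key := sum_mul_eq_of_exchange (weight m n p x) (fun cfg => cfg.1 t)
    (fun cfg b => (Function.update cfg.1 t b, cfg.2)) (fun b => if b then p t else 1 - p t)
    (by simp) (by simp) ?_ (by simp) h hh (fun b => if b then 1 else 0)
  · simpa [expect, arr] using key
  · intro cfg b
    have := prod_mul_eq_prod_mul
      (fun s => if Function.update cfg.1 t b s then p s else 1 - p s)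
      (fun s => if cfg.1 s then p s else 1 - p s) t
      (if cfg.1 t then p t else 1 - p t) (if b then p t else 1 - p t)
      (fun s hs => by simp [hs]) (by simp [mul_comm])
    simp only [weight]
    linear_combination (∏ t, x (cfg.2.1 t) t / p t) * (∏ t, x (cfg.2.2.1 t) t / p t) *
      (∏ i, ∏ t, if cfg.2.2.2 i t then q m n x i t else 1 - q m n x i t) * this

theorem expect_mul_coin (h : Cfg m n → ℝ) (t : Fin n) (j : Fin m)
    (hh : ∀ cfg b, h (cfg.1, cfg.2.1, cfg.2.2.1,
      Function.update cfg.2.2.2 j (Function.update (cfg.2.2.2 j) t b)) = h cfg) :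
    expect p x (fun cfg => h cfg * coin t j cfg) = expect p x h * q m n x j t := by
  have key := sum_mul_eq_of_exchange (weight m n p x) (fun cfg => cfg.2.2.2 j t)
    (fun cfg b => (cfg.1, cfg.2.1, cfg.2.2.1,
      Function.update cfg.2.2.2 j (Function.update (cfg.2.2.2 j) t b)))
    (fun b => if b then q m n x j t else 1 - q m n x j t)
    (by simp) (by simp) ?_ (by simp) h hh (fun b => if b then 1 else 0)
  · simpa [expect, coin] using key
  · intro cfg b
    have := prod_mul_eq_prod_mul
      (fun i => ∏ s, if Function.update cfg.2.2.2 j (Function.update (cfg.2.2.2 j) t b) i s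
        then q m n x i s else 1 - q m n x i s)
      (fun i => ∏ s, if cfg.2.2.2 i s then q m n x i s else 1 - q m n x i s) j
      (if cfg.2.2.2 j t then q m n x j t else 1 - q m n x j t)
      (if b then q m n x j t else 1 - q m n x j t)
      (fun i hi => by simp [hi])
      (prod_mul_eq_prod_mul _ _ t _ _ (fun s hs => by simp [hs]) (by simp [mul_comm]))
    simp only [weight]
    linear_combination (∏ t, if cfg.1 t then p t else 1 - p t) *
      (∏ t, x (cfg.2.1 t) t / p t) * (∏ t, x (cfg.2.2.1 t) t / p t) * this

theorem expect_past_arr (h : Cfg m n → ℝ) (t : Fin n) (hh : Past t.1 h) :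
    expect p x (fun cfg => h cfg * arr t cfg) = expect p x h * p t := by
  refine expect_mul_arr h t fun cfg b => hh _ _ fun s hs => ?_
  have : s ≠ t := fun e => by simp [e] at hs
  simp [this]

variable (hx : LPFeasible m n p x)
include hx

theorem sum_pick (t : Fin n) : ∑ j, x j t / p t = 1 := by
  rw [← Finset.sum_div, hx.2.2.2.1, div_self (hx.1 t).1.ne']

theorem expect_mul_pick1 (h : Cfg m n → ℝ) (t : Fin n) (j : Fin m)
    (hh : ∀ cfg k, h (cfg.1, Function.update cfg.2.1 t k, cfg.2.2) = h cfg) :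
    expect p x (fun cfg => h cfg * pick1 t j cfg) = expect p x h * (x j t / p t) := by
  have key := sum_mul_eq_of_exchange (weight m n p x) (fun cfg => cfg.2.1 t)
    (fun cfg k => (cfg.1, Function.update cfg.2.1 t k, cfg.2.2)) (fun k => x k t / p t)
    (by simp) (by simp) ?_ (sum_pick hx t) h hh (fun k => if k = j then 1 else 0)
  · simpa [expect, pick1] using key
  · intro cfg k
    have := prod_mul_eq_prod_mul (fun s => x (Function.update cfg.2.1 t k s) s / p s)
      (fun s => x (cfg.2.1 s) s / p s) t (x (cfg.2.1 t) t / p t) (x k t / p t)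
      (fun s hs => by simp [hs]) (by simp [mul_comm])
    simp only [weight]
    linear_combination (∏ t, if cfg.1 t then p t else 1 - p t) *
      (∏ t, x (cfg.2.2.1 t) t / p t) *
      (∏ i, ∏ t, if cfg.2.2.2 i t then q m n x i t else 1 - q m n x i t) * this

theorem expect_mul_pick2 (h : Cfg m n → ℝ) (t : Fin n) (j : Fin m)
    (hh : ∀ cfg k, h (cfg.1, cfg.2.1, Function.update cfg.2.2.1 t k, cfg.2.2.2) = h cfg) :
    expect p x (fun cfg => h cfg * pick2 t j cfg) = expect p x h * (x j t / p t) := by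
  have key := sum_mul_eq_of_exchange (weight m n p x) (fun cfg => cfg.2.2.1 t)
    (fun cfg k => (cfg.1, cfg.2.1, Function.update cfg.2.2.1 t k, cfg.2.2.2))
    (fun k => x k t / p t)
    (by simp) (by simp) ?_ (sum_pick hx t) h hh (fun k => if k = j then 1 else 0)
  · simpa [expect, pick2] using key
  · intro cfg k
    have := prod_mul_eq_prod_mul (fun s => x (Function.update cfg.2.2.1 t k s) s / p s)
      (fun s => x (cfg.2.2.1 s) s / p s) t (x (cfg.2.2.1 t) t / p t) (x k t / p t)
      (fun s hs => by simp [hs]) (by simp [mul_comm])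
    simp only [weight]
    linear_combination (∏ t, if cfg.1 t then p t else 1 - p t) *
      (∏ t, x (cfg.2.1 t) t / p t) *
      (∏ i, ∏ t, if cfg.2.2.2 i t then q m n x i t else 1 - q m n x i t) * this

theorem expect_past_pick1 (h : Cfg m n → ℝ) (t : Fin n) (j : Fin m) (hh : Past t.1 h) :
    expect p x (fun cfg => h cfg * arr t cfg * pick1 t j cfg) = expect p x h * x j t := by
  rw [expect_mul_pick1 hx, expect_past_arr h t hh]
  · have := (hx.1 t).1.ne'
    field_simp
  · intro cfg k
    congr 1
    refine hh _ _ fun s hs => ?_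
    have : s ≠ t := fun e => by simp [e] at hs
    simp [this]

theorem expect_past_pick2 (h : Cfg m n → ℝ) (t : Fin n) (j : Fin m) (hh : Past t.1 h) :
    expect p x (fun cfg => h cfg * arr t cfg * pick2 t j cfg) = expect p x h * x j t := by
  rw [expect_mul_pick2 hx, expect_past_arr h t hh]
  · have := (hx.1 t).1.ne'
    field_simp
  · intro cfg k
    congr 1
    refine hh _ _ fun s hs => ?_
    have : s ≠ t := fun e => by simp [e] at hs
    simp [this]

theorem expect_past_pick1_coin (h : Cfg m n → ℝ) (t : Fin n) (j : Fin m) (hh : Past t.1 h) :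
    expect p x (fun cfg => h cfg * arr t cfg * pick1 t j cfg * coin t j cfg) =
      expect p x h * x j t * q m n x j t := by
  rw [expect_mul_coin, expect_past_pick1 hx h t j hh]
  intro cfg b
  refine congrArg (· * arr t cfg * pick1 t j cfg) (hh _ _ fun s hs => ?_)
  have : s ≠ t := fun e => by simp [e] at hs
  refine ⟨rfl, rfl, rfl, fun i => ?_⟩
  by_cases hi : i = j
  · subst hi
    simp [this]
  · simp [hi]

theorem expect_past_pick1_pick2_coin (h : Cfg m n → ℝ) (t : Fin n) (j k : Fin m)
    (hh : Past t.1 h) :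
    expect p x (fun cfg => h cfg * arr t cfg * pick1 t j cfg * coin t j cfg * pick2 t k cfg) =
      expect p x h * x j t * q m n x j t * (x k t / p t) := by
  rw [expect_mul_pick2 hx, expect_past_pick1_coin hx h t j hh]
  intro cfg l
  refine congrArg (· * arr t cfg * pick1 t j cfg * coin t j cfg) (hh _ _ fun s hs => ?_)
  have : s ≠ t := fun e => by simp [e] at hs
  simp [this]

theorem S_le_one (i : Fin m) (t : Fin n) : S m n x i t ≤ 1 :=
  (Finset.sum_le_sum_of_subset_of_nonneg (Finset.filter_subset _ _)
    fun s _ _ => hx.2.1 i s).trans (hx.2.2.1 i)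

theorem q_nonneg (i : Fin m) (t : Fin n) : 0 ≤ q m n x i t := by
  have := S_le_one hx i t
  refine le_min zero_le_one (div_nonneg (by norm_num [c]) ?_)
  norm_num [c]
  linarith

omit hx in
theorem q_le_one (i : Fin m) (t : Fin n) : q m n x i t ≤ 1 := min_le_left _ _

theorem le_one (i : Fin m) (t : Fin n) : x i t ≤ 1 :=
  (Finset.single_le_sum (fun s _ => hx.2.1 i s) (mem_univ t)).trans (hx.2.2.1 i)

theorem weight_nonneg (cfg : Cfg m n) : 0 ≤ weight m n p x cfg := by
  have hpick : ∀ j t, 0 ≤ x j t / p t := fun j t => div_nonneg (hx.2.1 j t) (hx.1 t).1.le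
  refine mul_nonneg (mul_nonneg (mul_nonneg ?_ ?_) ?_) ?_
  · refine Finset.prod_nonneg fun t _ => ?_
    have := hx.1 t
    split_ifs <;> linarith
  · exact Finset.prod_nonneg fun t _ => hpick _ _
  · exact Finset.prod_nonneg fun t _ => hpick _ _
  · refine Finset.prod_nonneg fun i _ => Finset.prod_nonneg fun t _ => ?_
    have := q_nonneg hx i t
    have := q_le_one (x := x) i t
    split_ifs <;> linarith

theorem expect_mono {f g : Cfg m n → ℝ} (h : ∀ cfg, f cfg ≤ g cfg) :
    expect p x f ≤ expect p x g :=
  Finset.sum_le_sum fun cfg _ => mul_le_mul_of_nonneg_left (h cfg) (weight_nonneg hx cfg)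

theorem expect_nonneg {f : Cfg m n → ℝ} (h : ∀ cfg, 0 ≤ f cfg) : 0 ≤ expect p x f :=
  Finset.sum_nonneg fun cfg _ => mul_nonneg (weight_nonneg hx cfg) (h cfg)

theorem expect_one : expect p x (fun _ => 1) = 1 := by
  have hp : ∑ a : Fin n → Bool, (∏ t, if a t then p t else 1 - p t) = 1 := by
    rw [← Fintype.prod_sum fun t (b : Bool) => if b then p t else 1 - p t]
    simp
  have hpick : ∑ a : Fin n → Fin m, (∏ t, x (a t) t / p t) = 1 := by
    rw [← Fintype.prod_sum fun t j => x j t / p t]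
    exact Finset.prod_eq_one fun t _ => sum_pick hx t
  have hcoin : ∑ a : Fin m → Fin n → Bool,
      (∏ i, ∏ t, if a i t then q m n x i t else 1 - q m n x i t) = 1 := by
    rw [← Fintype.prod_sum fun i (r : Fin n → Bool) =>
      ∏ t, if r t then q m n x i t else 1 - q m n x i t]
    refine Finset.prod_eq_one fun i _ => ?_
    rw [← Fintype.prod_sum fun t (b : Bool) => if b then q m n x i t else 1 - q m n x i t]
    simp
  simp only [expect, weight, mul_one, Fintype.sum_prod_type]
  refine (sum_mul_mul_mul (fun a : Fin n → Bool => ∏ t, if a t then p t else 1 - p t)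
    (fun a : Fin n → Fin m => ∏ t, x (a t) t / p t)
    (fun a : Fin n → Fin m => ∏ t, x (a t) t / p t)
    (fun a : Fin m → Fin n → Bool =>
      ∏ i, ∏ t, if a i t then q m n x i t else 1 - q m n x i t)).trans ?_
  rw [hp, hpick, hcoin]
  norm_num

end Expectation

/-- The matching `M₁ ∪ M₂` built at times `< t`. -/
def matching (x : Fin m → Fin n → ℝ) (cfg : Cfg m n) (t : ℕ) : Finset (Fin m × Fin n) :=
  (proc m n x cfg t).1 ∪ (proc m n x cfg t).2

/-- The indicator that bin `i` is unmatched before time `t`. -/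
def free (x : Fin m → Fin n → ℝ) (t : ℕ) (i : Fin m) (cfg : Cfg m n) : ℝ :=
  if FreeBin m n (matching x cfg t) i then 1 else 0

/-- The indicator that edge `(i, t)` is matched at time `t`. -/
def matchedAt (x : Fin m → Fin n → ℝ) (t : Fin n) (i : Fin m) (cfg : Cfg m n) : ℝ :=
  if (i, t) ∈ matching x cfg (t.1 + 1) then 1 else 0

/-- The indicator that edge `(i, t)` is late. -/
def lateInd (x : Fin m → Fin n → ℝ) (i : Fin m) (t : Fin n) : ℝ :=
  if Late m n x i t then 1 else 0

section Matching

variable (x : Fin m → Fin n → ℝ)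

theorem matching_succ (cfg : Cfg m n) (t : Fin n) :
    matching x cfg (t.1 + 1) =
      if cfg.1 t = true ∧ FreeBin m n (matching x cfg t.1) (cfg.2.1 t) ∧
          cfg.2.2.2 (cfg.2.1 t) t = true then
        insert (cfg.2.1 t, t) (matching x cfg t.1)
      else if cfg.1 t = true ∧ FreeBin m n (matching x cfg t.1) (cfg.2.2.1 t) ∧
          Late m n x (cfg.2.2.1 t) t then
        insert (cfg.2.2.1 t, t) (matching x cfg t.1)
      else matching x cfg t.1 := by
  by_cases h1 : cfg.1 t = true ∧ FreeBin m n (matching x cfg t.1) (cfg.2.1 t) ∧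
      cfg.2.2.2 (cfg.2.1 t) t = true
  · have h : proc m n x cfg (t.1 + 1) =
        (insert (cfg.2.1 t, t) (proc m n x cfg t.1).1, (proc m n x cfg t.1).2) :=
      (dif_pos t.2).trans (if_pos h1)
    rw [if_pos h1, matching, h]
    exact Finset.insert_union _ _ _
  · rw [if_neg h1]
    by_cases h2 : cfg.1 t = true ∧ FreeBin m n (matching x cfg t.1) (cfg.2.2.1 t) ∧
        Late m n x (cfg.2.2.1 t) t
    · have h : proc m n x cfg (t.1 + 1) =
          ((proc m n x cfg t.1).1, insert (cfg.2.2.1 t, t) (proc m n x cfg t.1).2) :=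
        (dif_pos t.2).trans ((if_neg h1).trans (if_pos h2))
      rw [if_pos h2, matching, h]
      exact Finset.union_insert _ _ _
    · have h : proc m n x cfg (t.1 + 1) = proc m n x cfg t.1 :=
        (dif_pos t.2).trans ((if_neg h1).trans (if_neg h2))
      rw [if_neg h2, matching, h]
      rfl

theorem matching_mono (cfg : Cfg m n) : Monotone (matching x cfg) := by
  refine monotone_nat_of_le_succ fun t => ?_
  by_cases h : t < n
  · have := matching_succ x cfg ⟨t, h⟩
    simp only at this
    rw [this]
    split_ifs
    · exact Finset.subset_insert _ _
    · exact Finset.subset_insert _ _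
    · exact le_rfl
  · simp [matching, proc, h]

theorem lt_of_mem_matching (cfg : Cfg m n) (t : ℕ) (e : Fin m × Fin n)
    (he : e ∈ matching x cfg t) : e.2.1 < t := by
  induction t with
  | zero => simp [matching, proc] at he
  | succ t ih =>
    by_cases h : t < n
    · have := matching_succ x cfg ⟨t, h⟩
      simp only at this
      rw [this] at he
      split_ifs at he
      · rcases Finset.mem_insert.1 he with rfl | he
        · simp
        · exact (ih he).trans (Nat.lt_succ_self t)
      · rcases Finset.mem_insert.1 he with rfl | he
        · simp
        · exact (ih he).trans (Nat.lt_succ_self t)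
      · exact (ih he).trans (Nat.lt_succ_self t)
    · simp only [matching, proc, h, dif_neg, not_false_eq_true] at he
      exact (ih he).trans (Nat.lt_succ_self t)

theorem notMem_matching (cfg : Cfg m n) (t : Fin n) (i : Fin m) :
    (i, t) ∉ matching x cfg t.1 :=
  fun h => lt_irrefl _ (lt_of_mem_matching x cfg t.1 _ h)

theorem mem_matching_succ (cfg : Cfg m n) (t s : Fin n) (i : Fin m) (hs : s ≠ t) :
    (i, s) ∈ matching x cfg (t.1 + 1) ↔ (i, s) ∈ matching x cfg t.1 := by
  rw [matching_succ]
  split_ifs <;> simp [hs]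

theorem mem_matching_succ_iff (cfg : Cfg m n) (t : Fin n) (i : Fin m) :
    (i, t) ∈ matching x cfg (t.1 + 1) ↔
      (cfg.2.1 t = i ∧ cfg.1 t = true ∧ FreeBin m n (matching x cfg t.1) i ∧
        cfg.2.2.2 i t = true) ∨
      (¬ (cfg.1 t = true ∧ FreeBin m n (matching x cfg t.1) (cfg.2.1 t) ∧
        cfg.2.2.2 (cfg.2.1 t) t = true) ∧
        cfg.2.2.1 t = i ∧ cfg.1 t = true ∧ FreeBin m n (matching x cfg t.1) i ∧
        Late m n x i t) := by
  rw [matching_succ]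
  split_ifs with h1 h2 <;> simp only [Finset.mem_insert, notMem_matching, or_false,
    Prod.mk.injEq, and_true]
  all_goals grind

theorem proc_congr (t : ℕ) (cfg cfg' : Cfg m n)
    (h : ∀ s : Fin n, s.1 < t → cfg.1 s = cfg'.1 s ∧ cfg.2.1 s = cfg'.2.1 s ∧
      cfg.2.2.1 s = cfg'.2.2.1 s ∧ ∀ i, cfg.2.2.2 i s = cfg'.2.2.2 i s) :
    proc m n x cfg t = proc m n x cfg' t := by
  induction t with
  | zero => rfl
  | succ t ih =>
    have ih := ih fun s hs => h s (hs.trans (Nat.lt_succ_self t))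
    by_cases ht : t < n
    · obtain ⟨h1, h2, h3, h4⟩ := h ⟨t, ht⟩ (Nat.lt_succ_self t)
      simp only [proc, ih, h1, h2, h3, h4]
    · simp only [proc, ht, ih, dif_neg, not_false_eq_true]

theorem past_free (t : ℕ) (i : Fin m) : Past t (free x t i) := fun cfg cfg' h => by
  rw [free, free, matching, matching, proc_congr x t cfg cfg' h]

theorem past_free_mul_free (t : ℕ) (i j : Fin m) :
    Past t (fun cfg => free x t i cfg * free x t j cfg) := fun cfg cfg' h => by
  simp only [past_free x t _ cfg cfg' h]

theorem free_nonneg (t : ℕ) (i : Fin m) (cfg : Cfg m n) : 0 ≤ free x t i cfg := by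
  unfold free
  split_ifs <;> norm_num

theorem free_le_one (t : ℕ) (i : Fin m) (cfg : Cfg m n) : free x t i cfg ≤ 1 := by
  unfold free
  split_ifs <;> norm_num

theorem free_succ (t : Fin n) (i : Fin m) (cfg : Cfg m n) :
    free x (t.1 + 1) i cfg = free x t.1 i cfg - matchedAt x t i cfg := by
  have hiff : FreeBin m n (matching x cfg (t.1 + 1)) i ↔
      FreeBin m n (matching x cfg t.1) i ∧ (i, t) ∉ matching x cfg (t.1 + 1) := by
    refine ⟨fun h => ⟨fun s hs => h s (matching_mono x cfg (Nat.le_succ _) hs), h t⟩,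
      fun h s hs => ?_⟩
    rcases eq_or_ne s t with rfl | hne
    · exact h.2 hs
    · exact h.1 s ((mem_matching_succ x cfg t s i hne).1 hs)
  have himp : (i, t) ∈ matching x cfg (t.1 + 1) → FreeBin m n (matching x cfg t.1) i := by
    rw [matching_succ]
    split_ifs with h1 h2 <;> simp only [Finset.mem_insert, notMem_matching, or_false,
      Prod.mk.injEq, and_true, IsEmpty.forall_iff]
    · exact fun h => h ▸ h1.2.1
    · exact fun h => h ▸ h2.2.1
  simp only [free, matchedAt, hiff]
  by_cases h1 : (i, t) ∈ matching x cfg (t.1 + 1)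
  · simp [h1, himp h1]
  · simp [h1]

theorem matchedAt_eq (t : Fin n) (i : Fin m) (cfg : Cfg m n) :
    matchedAt x t i cfg = free x t.1 i cfg * arr t cfg * pick1 t i cfg * coin t i cfg +
      lateInd x i t * (free x t.1 i cfg * arr t cfg * pick2 t i cfg -
        ∑ j, free x t.1 i cfg * free x t.1 j cfg * arr t cfg * pick1 t j cfg * coin t j cfg *
          pick2 t i cfg) := by
  have hsum : ∑ j, free x t.1 i cfg * free x t.1 j cfg * arr t cfg * pick1 t j cfg *
      coin t j cfg * pick2 t i cfg = free x t.1 i cfg * free x t.1 (cfg.2.1 t) cfg * arr t cfg *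
        coin t (cfg.2.1 t) cfg * pick2 t i cfg := by
    rw [Finset.sum_eq_single (cfg.2.1 t)]
    · simp [pick1]
    · intro j _ hj
      simp [pick1, hj.symm]
    · simp
  rw [hsum]
  have hmem := mem_matching_succ_iff x cfg t i
  simp only [matchedAt, hmem, free, arr, pick1, pick2, coin, lateInd]
  by_cases h1 : cfg.2.1 t = i
  · rw [h1]
    by_cases ha : cfg.1 t = true <;> by_cases hf : FreeBin m n (matching x cfg t.1) i <;>
      by_cases hy : cfg.2.2.2 i t = true <;> by_cases h2 : cfg.2.2.1 t = i <;>
      by_cases hl : Late m n x i t <;> simp [ha, hf, hy, h2, hl]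
  · by_cases ha : cfg.1 t = true <;> by_cases hf : FreeBin m n (matching x cfg t.1) i <;>
      by_cases hg : FreeBin m n (matching x cfg t.1) (cfg.2.1 t) <;>
      by_cases hy : cfg.2.2.2 (cfg.2.1 t) t = true <;> by_cases h2 : cfg.2.2.1 t = i <;>
      by_cases hl : Late m n x i t <;> simp [h1, ha, hf, hg, hy, h2, hl]

theorem firstPick_le_matchedAt (t : Fin n) (i : Fin m) (cfg : Cfg m n) :
    free x t.1 i cfg * arr t cfg * pick1 t i cfg * coin t i cfg ≤ matchedAt x t i cfg := by
  by_cases h : cfg.1 t = true ∧ FreeBin m n (matching x cfg t.1) i ∧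
      cfg.2.1 t = i ∧ cfg.2.2.2 i t = true
  · obtain ⟨h1, h2, rfl, h4⟩ := h
    simp [matchedAt, matching_succ, free, arr, pick1, coin, h1, h2, h4]
  · have h0 : free x t.1 i cfg * arr t cfg * pick1 t i cfg * coin t i cfg = 0 := by
      simp only [free, arr, pick1, coin]
      split_ifs <;> simp_all
    rw [h0, matchedAt]
    split_ifs <;> norm_num

theorem free_mul_free_succ_le (t : Fin n) (i j : Fin m) (hij : i ≠ j) (cfg : Cfg m n) :
    free x (t.1 + 1) i cfg * free x (t.1 + 1) j cfg ≤
      free x t.1 i cfg * free x t.1 j cfg -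
        free x t.1 i cfg * free x t.1 j cfg * arr t cfg * pick1 t i cfg * coin t i cfg -
        free x t.1 i cfg * free x t.1 j cfg * arr t cfg * pick1 t j cfg * coin t j cfg := by
  have hi := firstPick_le_matchedAt x t i cfg
  have hj := firstPick_le_matchedAt x t j cfg
  have h0 : pick1 t i cfg * pick1 t j cfg = 0 := by
    simp only [pick1]
    split_ifs with h1 h2
    · exact absurd (h1.symm.trans h2) hij
    all_goals simp
  have hsi := free_nonneg x (t.1 + 1) i cfg
  have hsj := free_nonneg x (t.1 + 1) j cfg
  have hle : free x (t.1 + 1) i cfg * free x (t.1 + 1) j cfg ≤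
      (free x t.1 i cfg - free x t.1 i cfg * arr t cfg * pick1 t i cfg * coin t i cfg) *
        (free x t.1 j cfg - free x t.1 j cfg * arr t cfg * pick1 t j cfg * coin t j cfg) := by
    rw [free_succ] at hsi hsj ⊢
    rw [free_succ]
    exact mul_le_mul (by linarith) (by linarith) hsj (by linarith)
  refine hle.trans_eq ?_
  linear_combination (free x t.1 i cfg * arr t cfg * coin t i cfg) *
    (free x t.1 j cfg * arr t cfg * coin t j cfg) * h0

end Matching

section Bounds

variable {p : Fin n → ℝ} {x : Fin m → Fin n → ℝ}

/-- `∑_{s < t} x i s`, for `t` a natural number. -/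
def load (x : Fin m → Fin n → ℝ) (i : Fin m) (t : ℕ) : ℝ :=
  ∑ s ∈ univ.filter (fun s : Fin n => s.1 < t), x i s

/-- The probability that bin `i` is left unmatched by first picks alone before time `t`. -/
def survive (x : Fin m → Fin n → ℝ) (i : Fin m) (t : ℕ) : ℝ :=
  ∏ s ∈ univ.filter (fun s : Fin n => s.1 < t), (1 - x i s * q m n x i s)

theorem filter_lt_succ (t : Fin n) :
    univ.filter (fun s : Fin n => s.1 < t.1 + 1) =
      insert t (univ.filter fun s : Fin n => s.1 < t.1) := by
  ext s
  simp only [Finset.mem_filter, mem_univ, true_and, Finset.mem_insert, Fin.ext_iff]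
  omega

theorem load_succ (i : Fin m) (t : Fin n) : load x i (t.1 + 1) = load x i t.1 + x i t := by
  rw [load, filter_lt_succ, Finset.sum_insert (by simp), add_comm]
  rfl

theorem survive_succ (i : Fin m) (t : Fin n) :
    survive x i (t.1 + 1) = survive x i t.1 * (1 - x i t * q m n x i t) := by
  rw [survive, filter_lt_succ, Finset.prod_insert (by simp), mul_comm]
  rfl

theorem S_eq_load (i : Fin m) (t : Fin n) : S m n x i t = load x i t.1 := by
  simp only [S, load, Fin.lt_def]

theorem expect_free_succ (t : Fin n) (i : Fin m) :
    expect p x (free x (t.1 + 1) i) =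
      expect p x (free x t.1 i) - expect p x (matchedAt x t i) := by
  rw [← expect_sub]
  exact congrArg _ (funext (free_succ x t i))

variable (hx : LPFeasible m n p x)
include hx

theorem expect_matchedAt (t : Fin n) (i : Fin m) :
    expect p x (matchedAt x t i) = expect p x (free x t.1 i) * x i t * q m n x i t +
      lateInd x i t * (expect p x (free x t.1 i) * x i t -
        ∑ j, expect p x (fun cfg => free x t.1 i cfg * free x t.1 j cfg) * x j t * q m n x j t *
          (x i t / p t)) := by
  have heq : matchedAt x t i = fun cfg => _ := funext (matchedAt_eq x t i)
  rw [heq, expect_add, expect_past_pick1_coin hx _ t i (past_free x t.1 i), expect_const_mul,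
    expect_sub, expect_past_pick2 hx _ t i (past_free x t.1 i), expect_sum]
  congr 3
  refine Finset.sum_congr rfl fun j _ => ?_
  rw [← expect_past_pick1_pick2_coin hx _ t j i (past_free_mul_free x t.1 i j)]

theorem expect_free_succ_le (t : Fin n) (i : Fin m) :
    expect p x (free x (t.1 + 1) i) ≤
      expect p x (free x t.1 i) * (1 - x i t * q m n x i t) := by
  have h := expect_mono hx (firstPick_le_matchedAt x t i)
  rw [expect_past_pick1_coin hx _ t i (past_free x t.1 i)] at h
  change _ ≤ expect p x (matchedAt x t i) at h
  rw [expect_free_succ]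
  linarith

theorem expect_free_mul_free_succ_le (t : Fin n) (i j : Fin m) (hij : i ≠ j) :
    expect p x (fun cfg => free x (t.1 + 1) i cfg * free x (t.1 + 1) j cfg) ≤
      expect p x (fun cfg => free x t.1 i cfg * free x t.1 j cfg) *
        (1 - x i t * q m n x i t - x j t * q m n x j t) := by
  refine (expect_mono hx (free_mul_free_succ_le x t i j hij)).trans_eq ?_
  rw [expect_sub, expect_sub,
    expect_past_pick1_coin hx _ t i (past_free_mul_free x t.1 i j),
    expect_past_pick1_coin hx _ t j (past_free_mul_free x t.1 i j)]
  ring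

theorem expect_free_nonneg (t : ℕ) (i : Fin m) : 0 ≤ expect p x (free x t i) :=
  expect_nonneg hx (free_nonneg x t i)

theorem expect_free_mul_free_nonneg (t : ℕ) (i j : Fin m) :
    0 ≤ expect p x (fun cfg => free x t i cfg * free x t j cfg) :=
  expect_nonneg hx fun cfg => mul_nonneg (free_nonneg x t i cfg) (free_nonneg x t j cfg)

theorem expect_free_mul_free_le (t : ℕ) (i j : Fin m) :
    expect p x (fun cfg => free x t i cfg * free x t j cfg) ≤ expect p x (free x t i) :=
  expect_mono hx fun cfg =>
    mul_le_of_le_one_right (free_nonneg x t i cfg) (free_le_one x t j cfg)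

theorem expect_free_zero (i : Fin m) : expect p x (free x 0 i) = 1 := by
  rw [← expect_one hx]
  congr 1
  ext cfg
  simp [free, matching, proc, FreeBin]

theorem one_sub_nonneg (i : Fin m) (t : Fin n) : 0 ≤ 1 - x i t * q m n x i t := by
  have := mul_le_one₀ (le_one hx i t) (q_nonneg hx i t) (q_le_one i t)
  linarith

theorem survive_nonneg (i : Fin m) (t : ℕ) : 0 ≤ survive x i t :=
  Finset.prod_nonneg fun s _ => one_sub_nonneg hx i s

theorem expect_free_le_survive (i : Fin m) (t : ℕ) (ht : t ≤ n) :
    expect p x (free x t i) ≤ survive x i t := by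
  induction t with
  | zero => simp [expect_free_zero hx, survive]
  | succ t ih =>
    refine (expect_free_succ_le hx ⟨t, ht⟩ i).trans ?_
    have h := survive_succ (x := x) i ⟨t, ht⟩
    simp only at h ⊢
    rw [h]
    exact mul_le_mul_of_nonneg_right (ih (Nat.le_of_succ_le ht)) (one_sub_nonneg hx i _)

theorem expect_free_mul_free_le_survive (i j : Fin m) (hij : i ≠ j) (t : ℕ) (ht : t ≤ n) :
    expect p x (fun cfg => free x t i cfg * free x t j cfg) ≤ survive x i t * survive x j t := by
  induction t with
  | zero =>
    refine (expect_free_mul_free_le hx 0 i j).trans ?_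
    simp [expect_free_zero hx, survive]
  | succ t ih =>
    refine (expect_free_mul_free_succ_le hx ⟨t, ht⟩ i j hij).trans ?_
    have hi := survive_succ (x := x) i ⟨t, ht⟩
    have hj := survive_succ (x := x) j ⟨t, ht⟩
    simp only at hi hj ⊢
    rw [hi, hj]
    set T : Fin n := ⟨t, ht⟩
    have ai := mul_nonneg (hx.2.1 i T) (q_nonneg hx i T)
    have aj := mul_nonneg (hx.2.1 j T) (q_nonneg hx j T)
    calc _ ≤ expect p x (fun cfg => free x t i cfg * free x t j cfg) *
          ((1 - x i T * q m n x i T) * (1 - x j T * q m n x j T)) := by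
          refine mul_le_mul_of_nonneg_left ?_ (expect_free_mul_free_nonneg hx t i j)
          nlinarith [mul_nonneg ai aj]
      _ ≤ survive x i t * survive x j t *
          ((1 - x i T * q m n x i T) * (1 - x j T * q m n x j T)) :=
          mul_le_mul_of_nonneg_right (ih (Nat.le_of_succ_le ht))
            (mul_nonneg (one_sub_nonneg hx i T) (one_sub_nonneg hx j T))
      _ = _ := by ring

omit hx in
theorem early_iff (i : Fin m) (t : Fin n) : Early m n x i t ↔ load x i t.1 ≤ 49 / 51 := by
  rw [Early, S_eq_load]
  norm_num [c]

omit hx in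
theorem q_early (i : Fin m) (t : Fin n) (h : load x i t.1 ≤ 49 / 51) :
    (1 - 51 / 100 * load x i t.1) * q m n x i t = 51 / 100 := by
  have hpos : 0 < 1 - 51 / 100 * load x i t.1 := by linarith
  have hq : q m n x i t = (51 / 100) / (1 - 51 / 100 * load x i t.1) := by
    rw [q, S_eq_load]
    norm_num [c]
    rw [div_le_one hpos]
    linarith
  rw [hq, mul_div_cancel₀ _ hpos.ne']

omit hx in
theorem q_late (i : Fin m) (t : Fin n) (h : 49 / 51 < load x i t.1) (h1 : load x i t.1 ≤ 1) :
    q m n x i t = 1 := by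
  have hpos : 0 < 1 - 51 / 100 * load x i t.1 := by linarith
  rw [q, S_eq_load]
  norm_num [c]
  rw [le_div_iff₀ hpos]
  linarith

theorem expect_matchedAt_le (t : Fin n) (i : Fin m) :
    expect p x (matchedAt x t i) ≤ 2 * (expect p x (free x t.1 i) * x i t) := by
  have hv := mul_nonneg (expect_free_nonneg hx t.1 i) (hx.2.1 i t)
  have hsum : 0 ≤ ∑ j, expect p x (fun cfg => free x t.1 i cfg * free x t.1 j cfg) * x j t *
      q m n x j t * (x i t / p t) :=
    Finset.sum_nonneg fun j _ => mul_nonneg (mul_nonneg (mul_nonneg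
      (expect_free_mul_free_nonneg hx t.1 i j) (hx.2.1 j t)) (q_nonneg hx j t))
      (div_nonneg (hx.2.1 i t) (hx.1 t).1.le)
  have hq := mul_le_of_le_one_right hv (q_le_one (x := x) i t)
  rw [expect_matchedAt hx, lateInd]
  split_ifs <;> linarith

theorem free_bounds (i : Fin m) (t : ℕ) (ht : t ≤ n) :
    (load x i t ≤ 49 / 51 → expect p x (free x t i) = 1 - 51 / 100 * load x i t ∧
      survive x i t = 1 - 51 / 100 * load x i t) ∧
    (49 / 51 < load x i t → 149 / 100 - 102 / 100 * load x i t ≤ expect p x (free x t i) ∧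
      survive x i t ≤ 51 / 100) := by
  induction t with
  | zero =>
    have h0 : load x i 0 = 0 := by simp [load]
    simp only [h0]
    refine ⟨fun _ => by simp [expect_free_zero hx, survive], fun h => ?_⟩
    norm_num at h
  | succ t ih =>
    obtain ⟨ih1, ih2⟩ := ih (Nat.le_of_succ_le ht)
    have hw := survive_succ (x := x) i ⟨t, ht⟩
    have hl := load_succ (x := x) i ⟨t, ht⟩
    have hv := expect_free_succ (p := p) (x := x) ⟨t, ht⟩ i
    have hm := expect_matchedAt hx ⟨t, ht⟩ i
    have hle := expect_matchedAt_le hx ⟨t, ht⟩ i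
    have hvw := expect_free_le_survive hx i t (Nat.le_of_succ_le ht)
    have hw0 := survive_nonneg hx i t
    have hearly := early_iff (x := x) i ⟨t, ht⟩
    have hqe := q_early (x := x) i ⟨t, ht⟩
    have hT0 := hx.2.1 i ⟨t, ht⟩
    have hsub := mul_nonneg hT0 (q_nonneg hx i ⟨t, ht⟩)
    set T : Fin n := ⟨t, ht⟩
    simp only [T] at hw hl hv hm hle hqe hearly
    rcases le_or_gt (load x i t) (49 / 51) with he | he
    · obtain ⟨hv0, hw1⟩ := ih1 he
      have hlate : lateInd x i T = 0 := by simp [lateInd, Late, hearly, he, T]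
      have hqe := hqe he
      have e1 : expect p x (free x (t + 1) i) = 1 - 51 / 100 * load x i (t + 1) := by
        rw [hv, hm, hlate, hl, hv0]
        linear_combination (-x i T) * hqe
      have e2 : survive x i (t + 1) = 1 - 51 / 100 * load x i (t + 1) := by
        rw [hw, hl, hw1]
        linear_combination (-x i T) * hqe
      exact ⟨fun _ => ⟨e1, e2⟩, fun h => ⟨by linarith, by linarith⟩⟩
    · obtain ⟨hv0, hw1⟩ := ih2 he
      refine ⟨fun h => by linarith, fun _ => ⟨?_, ?_⟩⟩
      · have := mul_le_mul_of_nonneg_right (hvw.trans hw1) hT0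
        linarith
      · rw [hw]
        have := mul_nonneg hw0 hsub
        linarith

omit hx in
theorem matchedAt_le_indicator (t : Fin n) (i : Fin m) (cfg : Cfg m n) :
    matchedAt x t i cfg ≤ if (i, t) ∈ MF m n x cfg then 1 else 0 := by
  have : (i, t) ∈ matching x cfg (t.1 + 1) → (i, t) ∈ MF m n x cfg :=
    fun h => matching_mono x cfg t.2 h
  unfold matchedAt
  split_ifs <;> simp_all

theorem expect_matchedAt_le_Pr (t : Fin n) (i : Fin m) :
    expect p x (matchedAt x t i) ≤ Pr m n p x {cfg | (i, t) ∈ MF m n x cfg} := by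
  refine (expect_mono hx (matchedAt_le_indicator t i)).trans_eq ?_
  refine Finset.sum_congr rfl fun cfg _ => ?_
  by_cases h : (i, t) ∈ MF m n x cfg <;> simp [h]

theorem load_le_one (i : Fin m) (t : Fin n) : load x i t.1 ≤ 1 :=
  S_eq_load (x := x) i t ▸ S_le_one hx i t

theorem survive_mul_q_le (j : Fin m) (t : Fin n) :
    survive x j t.1 * q m n x j t ≤ 51 / 100 := by
  rcases le_or_gt (load x j t.1) (49 / 51) with he | he
  · rw [((free_bounds hx j t.1 t.2.le).1 he).2, q_early j t he]
  · rw [q_late j t he (load_le_one hx j t), mul_one]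
    exact ((free_bounds hx j t.1 t.2.le).2 he).2

/-- For a late bin `i`, an upper bound on `p t` times the probability, given that ball `t` arrives,
that bin `i` is free before time `t` and yet ball `t` is matched by its first pick. -/
theorem second_pick_bound (t : Fin n) (i : Fin m) (he : 49 / 51 < load x i t.1) :
    ∑ j, expect p x (fun cfg => free x t.1 i cfg * free x t.1 j cfg) * x j t * q m n x j t ≤
      expect p x (free x t.1 i) * x i t + (51 / 100) ^ 2 * (p t - x i t) := by
  have hp : ∑ j ∈ univ.erase i, x j t = p t - x i t := by
    rw [← hx.2.2.2.1 t, ← Finset.add_sum_erase univ _ (mem_univ i)]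
    ring
  rw [← Finset.add_sum_erase univ _ (mem_univ i), ← hp, Finset.mul_sum]
  refine add_le_add ?_ (Finset.sum_le_sum fun j hj => ?_)
  · refine (mul_le_of_le_one_right ?_ (q_le_one i t)).trans ?_
    · exact mul_nonneg (expect_free_mul_free_nonneg hx t.1 i i) (hx.2.1 i t)
    · exact mul_le_mul_of_nonneg_right (expect_free_mul_free_le hx t.1 i i) (hx.2.1 i t)
  · have hu := expect_free_mul_free_le_survive hx i j (Finset.ne_of_mem_erase hj).symm t.1 t.2.le
    have hwi := ((free_bounds hx i t.1 t.2.le).2 he).2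
    have hxj := hx.2.1 j t
    have hq := q_nonneg hx j t
    calc _ ≤ survive x i t.1 * survive x j t.1 * x j t * q m n x j t := by gcongr
      _ = survive x i t.1 * (survive x j t.1 * q m n x j t) * x j t := by ring
      _ ≤ 51 / 100 * (51 / 100) * x j t := by
        have := survive_mul_q_le hx j t
        have := mul_nonneg (survive_nonneg hx j t.1) hq
        gcongr
      _ = _ := by ring

theorem le_expect_matchedAt (t : Fin n) (i : Fin m) :
    x i t * (51 / 100) ≤ expect p x (matchedAt x t i) := by
  obtain ⟨hb1, hb2⟩ := free_bounds hx i t.1 t.2.le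
  have hx0 := hx.2.1 i t
  rw [expect_matchedAt hx, ← Finset.sum_mul]
  rcases le_or_gt (load x i t.1) (49 / 51) with he | he
  · have hlate : lateInd x i t = 0 := by simp [lateInd, Late, early_iff, he]
    rw [hlate, (hb1 he).1]
    linarith [congrArg (x i t * ·) (q_early i t he)]
  · have hlate : lateInd x i t = 1 := by simp [lateInd, Late, early_iff, he]
    have hl := load_le_one hx i t
    rw [hlate, q_late i t he hl]
    have hv := (hb2 he).1
    have hs := second_pick_bound hx t i he
    have hp0 := (hx.1 t).1
    have hlp := hx.2.2.2.2 i t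
    rw [S_eq_load] at hlp
    set v := expect p x (free x t.1 i)
    set y := x i t / p t with hy
    have hxy : x i t = y * p t := by rw [hy, div_mul_cancel₀ _ hp0.ne']
    have hy0 : 0 ≤ y := div_nonneg hx0 hp0.le
    have hy1 : y ≤ 2 / 51 := by
      rw [hy, div_le_iff₀ hp0]
      nlinarith
    have hfinal : 51 / 100 ≤ v + v - (v * y + (51 / 100) ^ 2 * (1 - y)) := by
      have hv2 : 47 / 100 ≤ v := by linarith
      nlinarith [mul_nonneg (sub_nonneg.2 hv2) hy0, mul_nonneg (sub_nonneg.2 hv2)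
        (sub_nonneg.2 hy1)]
    have h1 := mul_le_mul_of_nonneg_right hs hy0
    have h2 := mul_le_mul_of_nonneg_left hfinal hx0
    rw [hxy] at h1 h2 ⊢
    nlinarith

end Bounds

variable (m n)

/-- in the rounding process with LP-feasible `x`, every edge `(i,t)` is
matched with probability at least `x_{i,t}·(1/2 + c)`. -/
theorem edge_matched_prob (p : Fin n → ℝ) (x : Fin m → Fin n → ℝ)
    (hx : LPFeasible m n p x) (i : Fin m) (t : Fin n) :
    x i t * (1/2 + c) ≤ Pr m n p x {cfg | (i, t) ∈ MF m n x cfg} := by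
  have h := (le_expect_matchedAt hx t i).trans (expect_matchedAt_le_Pr hx t i)
  norm_num [c] at h ⊢
  exact h

end Rounding
end
end
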